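/- There exists an absolute constant C > 0 with the following property. Let u be a smooth global solution of the defocusing quintic nonlinear wave equation with E(u(t)) ≤ E for all t ∈ ℝ. Then for every T > 0, every t ∈ ℝ, every s with 0 ≤ s ≤ t − T, and every x ∈ ℝ³, the Duhamel integral satisfies the pointwise bound | ∫_{0}^{s} (1/(4π(t−τ))) ∫_{|x−x'| = t−τ} u(τ,x')⁵ dS(x') dτ | ≤ C E^{5/6} T^{−1/2}. -/

import Mathlib

open MeasureTheory Real Set Function
open scoped ENNReal NNReal FourierTransform

noncomputable section

/-- Three-dimensional Euclidean space `ℝ³`. -/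
abbrev E3 : Type := EuclideanSpace ℝ (Fin 3)

/-- The time derivative `∂ₜ u` of a function `u : ℝ × ℝ³ → ℝ` (curried). -/
def tderiv (u : ℝ → E3 → ℝ) (t : ℝ) (x : E3) : ℝ := deriv (fun s => u s x) t

/-- The second time derivative `∂ₜ² u`. -/
def tderiv2 (u : ℝ → E3 → ℝ) (t : ℝ) (x : E3) : ℝ := deriv (fun s => tderiv u s x) t

/-- The spatial Laplacian `Δ f = ∑ᵢ ∂ᵢ² f` of `f : ℝ³ → ℝ`. -/
def lap (f : E3 → ℝ) (x : E3) : ℝ :=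
  ∑ i : Fin 3, iteratedFDeriv ℝ 2 f x ![EuclideanSpace.single i 1, EuclideanSpace.single i 1]

/-- `f : ℝ³ → ℝ` is a Schwartz function: it is smooth and all of its derivatives decay
faster than any polynomial. -/
def IsSchwartz (f : E3 → ℝ) : Prop :=
  ContDiff ℝ (⊤ : ℕ∞) f ∧ ∀ k n : ℕ, ∃ C : ℝ, ∀ x, ‖x‖ ^ k * ‖iteratedFDeriv ℝ n f x‖ ≤ C

/-- `u` is a smooth solution of the defocusing quintic nonlinear wave equation
`∂ₜ²u − Δu + u⁵ = 0` on the time interval `I`, Schwartz in the space variable at each time. -/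
def IsNLWOn (u : ℝ → E3 → ℝ) (I : Set ℝ) : Prop :=
  ContDiffOn ℝ (⊤ : ℕ∞) (uncurry u) (I ×ˢ univ) ∧
  (∀ t ∈ I, IsSchwartz (u t) ∧ IsSchwartz (tderiv u t)) ∧
  (∀ t ∈ I, ∀ x, tderiv2 u t x - lap (u t) x + (u t x) ^ 5 = 0)

/-- `u` is a smooth global solution of the defocusing quintic nonlinear wave equation. -/
def IsNLW (u : ℝ → E3 → ℝ) : Prop := IsNLWOn u univ

/-- The energy `E(u(t)) = ∫ (1/2)|∂ₜu|² + (1/2)|∇ₓu|² + (1/6)u⁶ dx`. -/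
def energy (u : ℝ → E3 → ℝ) (t : ℝ) : ℝ :=
  ∫ x : E3, ((1/2) * (tderiv u t x) ^ 2 + (1/2) * ‖gradient (u t) x‖ ^ 2 + (1/6) * (u t x) ^ 6)

/-- The spatial `L^q` norm (`q` finite), valued in `ℝ≥0∞`. -/
def xNorm {F : Type*} [NormedAddCommGroup F] (q : ℝ) (f : E3 → F) : ℝ≥0∞ :=
  (∫⁻ x : E3, (‖f x‖₊ : ℝ≥0∞) ^ q) ^ (1/q)

/-- The mixed norm `‖u‖_{L^p_t L^q_x (I × ℝ³)}` for finite `p, q`. -/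
def mixNorm (p q : ℝ) (I : Set ℝ) (u : ℝ → E3 → ℝ) : ℝ≥0∞ :=
  (∫⁻ t in I, (xNorm q (u t)) ^ p) ^ (1/p)

/-- The mixed norm `‖u‖_{L^∞_t L^q_x (I × ℝ³)}` (essential supremum in time). -/
def supNorm (q : ℝ) (I : Set ℝ) (u : ℝ → E3 → ℝ) : ℝ≥0∞ :=
  essSup (fun t => xNorm q (u t)) (volume.restrict I)

/-- The homogeneous Sobolev norm `‖f‖_{Ḣ^s} = (∫ |ξ|^{2s} |𝓕f(ξ)|² dξ)^{1/2}`. -/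
def sobNorm (s : ℝ) (f : E3 → ℝ) : ℝ≥0∞ :=
  (∫⁻ ξ : E3, (‖ξ‖₊ : ℝ≥0∞) ^ (2*s) *
    (‖𝓕 (fun x => (f x : ℂ)) ξ‖₊ : ℝ≥0∞) ^ (2:ℝ)) ^ ((1:ℝ)/2)

/-- The a priori bounds with constant `A`:
`‖u(t)‖_{L²} ≤ A`, `‖∂ₜu(t)‖_{Ḣ⁻¹} ≤ A`, `‖u(t)‖_{Ḣ²} ≤ A`, `‖∂ₜu(t)‖_{Ḣ¹} ≤ A` for all `t`. -/
def APriori (u : ℝ → E3 → ℝ) (A : ℝ) : Prop :=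
  ∀ t : ℝ, xNorm 2 (u t) ≤ ENNReal.ofReal A ∧ sobNorm (-1) (tderiv u t) ≤ ENNReal.ofReal A ∧
    sobNorm 2 (u t) ≤ ENNReal.ofReal A ∧ sobNorm 1 (tderiv u t) ≤ ENNReal.ofReal A

/-- The integral of `f` over the sphere of radius `r` about `x`, with respect to
two-dimensional Hausdorff (surface) measure. -/
def sphInt (x : E3) (r : ℝ) (f : E3 → ℝ) : ℝ := ∫ y in Metric.sphere x r, f y ∂(μH[2])

/-- The free wave evolution `S(t)(g, h)` given by Kirchhoff's formula. -/
def freeWave (g h : E3 → ℝ) (t : ℝ) (x : E3) : ℝ :=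
  if t = 0 then g x
  else deriv (fun s => (1/(4*π*s)) * sphInt x s g) t + (1/(4*π*t)) * sphInt x t h

/-- The Duhamel integral `D_{[s₁,s₂]}u(t,x) = ∫_{s₁}^{s₂} S(t−τ)(0, u(τ)⁵) dτ`,
written via Kirchhoff's formula. -/
def duh (u : ℝ → E3 → ℝ) (s₁ s₂ : ℝ) (t : ℝ) (x : E3) : ℝ :=
  ∫ τ in s₁..s₂, (1/(4*π*(t - τ))) * sphInt x (t - τ) (fun y => (u τ y) ^ 5)



lemma lipschitzOnWith_radial_chart (i : Fin 3) :
    LipschitzOnWith 4 (fun (z : E3) (j : Fin 3) => if j = i then ‖z‖ else z j / ‖z‖)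
      {z : E3 | 1 / 2 ≤ ‖z‖} := by
  refine LipschitzOnWith.of_dist_le_mul fun z hz w hw => ?_
  have hz0 : 0 < ‖z‖ := lt_of_lt_of_le (by norm_num) hz
  have hw0 : 0 < ‖w‖ := lt_of_lt_of_le (by norm_num) hw
  have hnn : |‖w‖ - ‖z‖| ≤ dist z w := by
    rw [dist_eq_norm, norm_sub_rev]; exact abs_norm_sub_norm_le w z
  refine (dist_pi_le_iff (by positivity)).2 fun j => ?_
  have hcoord : |z j - w j| ≤ dist z w := by
    rw [dist_eq_norm]; simpa using PiLp.norm_apply_le (z - w) j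
  have hwj : |w j| ≤ ‖w‖ := by simpa using PiLp.norm_apply_le w j
  by_cases hj : j = i
  · simp only [hj, if_true, Real.dist_eq]
    rw [abs_sub_comm]
    refine hnn.trans ?_
    have := dist_nonneg (x := z) (y := w)
    norm_num; linarith
  · simp only [hj, if_false, Real.dist_eq]
    have h : z j / ‖z‖ - w j / ‖w‖
        = (z j - w j) / ‖z‖ + (w j / ‖w‖) * ((‖w‖ - ‖z‖) / ‖z‖) := by
      field_simp; ring
    have hinv : ∀ a : ℝ, |a| ≤ dist z w → |a / ‖z‖| ≤ 2 * dist z w := fun a ha => by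
      rw [abs_div, abs_of_pos hz0, div_le_iff₀ hz0]
      have : (1 / 2 : ℝ) ≤ ‖z‖ := hz
      nlinarith [abs_nonneg a, dist_nonneg (x := z) (y := w)]
    have h1 : |w j / ‖w‖| ≤ 1 := by
      rw [abs_div, abs_of_pos hw0]; exact div_le_one_of_le₀ hwj hw0.le
    rw [h]
    refine (abs_add_le _ _).trans ?_
    rw [abs_mul]
    have := mul_le_mul h1 (hinv _ hnn) (abs_nonneg _) zero_le_one
    have := hinv _ hcoord
    norm_num; linarith

lemma dist_le_of_mem_sphere_cap (i : Fin 3) {v w : E3} {e : ℝ} (he : |e| = 1)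
    (hv : ‖v‖ = 1) (hw : ‖w‖ = 1) (hvi : 1 / 2 ≤ e * v i) (hwi : 1 / 2 ≤ e * w i) :
    dist v w ≤ 6 * dist (fun k : Fin 2 => v (i.succAbove k)) (fun k : Fin 2 => w (i.succAbove k)) := by
  set d := dist (fun k : Fin 2 => v (i.succAbove k)) (fun k : Fin 2 => w (i.succAbove k)) with hd
  have hd0 : 0 ≤ d := dist_nonneg
  have hk : ∀ k : Fin 2, |v (i.succAbove k) - w (i.succAbove k)| ≤ d := fun k =>
    dist_le_pi_dist (fun k : Fin 2 => v (i.succAbove k)) (fun k : Fin 2 => w (i.succAbove k)) k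
  have hcv : ∀ j, |v j| ≤ 1 := fun j => by simpa [hv] using PiLp.norm_apply_le v j
  have hcw : ∀ j, |w j| ≤ 1 := fun j => by simpa [hw] using PiLp.norm_apply_le w j
  have hsum : ∀ z : E3, ‖z‖ ^ 2 = z i ^ 2 + (z (i.succAbove 0) ^ 2 + z (i.succAbove 1) ^ 2) :=
    fun z => by
      rw [EuclideanSpace.real_norm_sq_eq, Fin.sum_univ_succAbove _ i, Fin.sum_univ_two]
  have hsv := hsum v
  have hsw := hsum w
  rw [hv] at hsv
  rw [hw] at hsw
  have hsq : ∀ j, |v j - w j| ≤ d → |v j ^ 2 - w j ^ 2| ≤ 2 * d := fun j hj => by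
    have : v j ^ 2 - w j ^ 2 = (v j - w j) * (v j + w j) := by ring
    rw [this, abs_mul]
    have h2 : |v j + w j| ≤ 2 := (abs_add_le _ _).trans (by linarith [hcv j, hcw j])
    nlinarith [abs_nonneg (v j - w j), abs_nonneg (v j + w j)]
  have h0 := hsq _ (hk 0)
  have h1 := hsq _ (hk 1)
  have hi : |v i - w i| ≤ 4 * d := by
    have hee : e * e = 1 := by rw [← abs_mul_abs_self, he, one_mul]
    have hprod : |v i - w i| * (e * (v i + w i)) = |v i ^ 2 - w i ^ 2| := by
      have hp : 0 ≤ e * (v i + w i) := by linarith [mul_add e (v i) (w i)]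
      rw [← abs_of_nonneg hp, abs_mul, he, one_mul, ← abs_mul]
      congr 1; ring
    have hle : |v i ^ 2 - w i ^ 2| ≤ 4 * d := by
      rw [abs_le] at *
      constructor <;> linarith [h0.1, h0.2, h1.1, h1.2]
    have : 1 ≤ e * (v i + w i) := by linarith [mul_add e (v i) (w i)]
    nlinarith [abs_nonneg (v i - w i)]
  rw [dist_eq_norm]
  have hs := hsum (v - w)
  simp only [PiLp.sub_apply] at hs
  have e0 := sq_le_sq' (neg_le_of_abs_le (hk 0)) (le_of_abs_le (hk 0))
  have e1 := sq_le_sq' (neg_le_of_abs_le (hk 1)) (le_of_abs_le (hk 1))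
  have ei := sq_le_sq' (neg_le_of_abs_le hi) (le_of_abs_le hi)
  exact abs_le_of_sq_le_sq' (by nlinarith) (by positivity) |>.2

lemma volume_succAbove_cylinder (i : Fin 3) (Q : Set (Fin 2 → ℝ)) (I : Set ℝ) :
    volume {y : Fin 3 → ℝ | y i ∈ I ∧ (fun k : Fin 2 => y (i.succAbove k)) ∈ Q}
      = volume I * volume Q := by
  have h := (volume_preserving_piFinSuccAbove (fun _ : Fin 3 => ℝ) i).measure_preimage_equiv
    (I ×ˢ Q)
  rw [Measure.volume_eq_prod, Measure.prod_prod] at h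
  rw [← h]
  rfl

open scoped Pointwise in
lemma exists_hausdorffMeasure_cap_le :
    ∃ K : ℝ≥0∞, K ≠ ∞ ∧ ∀ (i : Fin 3) (e : ℝ), |e| = 1 → ∀ B : Set E3,
      (∀ v ∈ B, ‖v‖ = 1 ∧ 1 / 2 ≤ e * v i) →
      μH[2] B ≤ K * volume (Ioo (0 : ℝ) 1 • B) := by
  have h3 : (Module.finrank ℝ E3 : ℝ) = 3 := by simp
  have : (μH[3] : Measure E3).IsAddHaarMeasure := by
    rw [← h3]; infer_instance
  obtain ⟨c, hc⟩ : ∃ c : ℝ≥0, (μH[3] : Measure E3) = c • volume :=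
    ⟨_, Measure.isAddLeftInvariant_eq_smul _ _⟩
  refine ⟨(6 : ℝ≥0∞) ^ (2 : ℝ) * (2 * ((4 : ℝ≥0∞) ^ (3 : ℝ) * c)), ?_, fun i e he B hB => ?_⟩
  · exact ENNReal.mul_ne_top (ENNReal.rpow_ne_top_of_nonneg (by norm_num) (by norm_num))
      (ENNReal.mul_ne_top (by norm_num) (ENNReal.mul_ne_top
        (ENNReal.rpow_ne_top_of_nonneg (by norm_num) (by norm_num)) ENNReal.coe_ne_top))
  let P : E3 → Fin 2 → ℝ := fun v k => v (i.succAbove k)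
  let F : E3 → Fin 3 → ℝ := fun z j => if j = i then ‖z‖ else z j / ‖z‖
  have hPd : ∀ v ∈ B, ∀ w ∈ B, dist v w ≤ 6 * dist (P v) (P w) := fun v hv w hw =>
    dist_le_of_mem_sphere_cap i he (hB v hv).1 (hB w hw).1 (hB v hv).2 (hB w hw).2
  have hinj : InjOn P B := fun v hv w hw h => by
    have := hPd v hv w hw
    rw [h, dist_self, mul_zero] at this
    exact dist_le_zero.1 this
  have hleft : ∀ v ∈ B, invFunOn P B (P v) = v := fun v hv => hinj.leftInvOn_invFunOn hv
  have hlip : LipschitzOnWith 6 (invFunOn P B) (P '' B) := by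
    refine LipschitzOnWith.of_dist_le_mul ?_
    rintro _ ⟨v, hv, rfl⟩ _ ⟨w, hw, rfl⟩
    rw [hleft v hv, hleft w hw]
    exact hPd v hv w hw
  have himg : invFunOn P B '' (P '' B) = B := by
    rw [image_image]
    exact (image_congr hleft).trans (image_id' B)
  have hproj : μH[2] B ≤ (6 : ℝ≥0∞) ^ (2 : ℝ) * volume (P '' B) := by
    have := hlip.hausdorffMeasure_image_le (d := 2) (by norm_num)
    rw [himg] at this
    have hv : (μH[2] : Measure (Fin 2 → ℝ)) = volume := by
      rw [← hausdorffMeasure_pi_real]; simp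
    rw [hv] at this
    exact_mod_cast this
  have hcylinder : volume (P '' B) ≤ 2 * volume (F '' (Ioo (1 / 2 : ℝ) 1 • B)) := by
    have hsub : {y : Fin 3 → ℝ | y i ∈ Ioo (1 / 2 : ℝ) 1 ∧
        (fun k : Fin 2 => y (i.succAbove k)) ∈ P '' B} ⊆ F '' (Ioo (1 / 2 : ℝ) 1 • B) := by
      rintro y ⟨hy, v, hv, hvy⟩
      refine ⟨y i • v, Set.smul_mem_smul hy hv, ?_⟩
      have hpos : 0 < y i := lt_trans (by norm_num) hy.1
      have hn : ‖y i • v‖ = y i := by rw [norm_smul, (hB v hv).1, mul_one, Real.norm_of_nonneg hpos.le]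
      funext j
      rcases Fin.eq_self_or_eq_succAbove i j with rfl | ⟨k, rfl⟩
      · simp only [F, if_true, hn]
      · simp only [F, Fin.succAbove_ne, if_false, hn, PiLp.smul_apply, smul_eq_mul]
        rw [mul_div_cancel_left₀ _ hpos.ne']
        exact congrFun hvy k
    have := measure_mono (μ := volume) hsub
    rw [volume_succAbove_cylinder, Real.volume_Ioo] at this
    calc volume (P '' B) = 2 * (ENNReal.ofReal (1 - 1 / 2) * volume (P '' B)) := by
          rw [← mul_assoc, show (2 : ℝ≥0∞) = ENNReal.ofReal 2 by simp,
            ← ENNReal.ofReal_mul (by norm_num)]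
          norm_num
      _ ≤ _ := by gcongr
  have hvolume : volume (F '' (Ioo (1 / 2 : ℝ) 1 • B)) ≤
      (4 : ℝ≥0∞) ^ (3 : ℝ) * (c * volume (Ioo (0 : ℝ) 1 • B)) := by
    have hs : Ioo (1 / 2 : ℝ) 1 • B ⊆ {z : E3 | 1 / 2 ≤ ‖z‖} := by
      rintro _ ⟨r, hr, v, hv, rfl⟩
      have hpos : 0 < r := lt_trans (by norm_num) hr.1
      change 1 / 2 ≤ ‖r • v‖
      rw [norm_smul, (hB v hv).1, mul_one, Real.norm_of_nonneg hpos.le]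
      exact hr.1.le
    have := ((lipschitzOnWith_radial_chart i).mono hs).hausdorffMeasure_image_le
      (d := 3) (by norm_num)
    have hv : (μH[3] : Measure (Fin 3 → ℝ)) = volume := by
      rw [← hausdorffMeasure_pi_real]; simp
    rw [hv, hc] at this
    refine this.trans ?_
    simp only [Measure.smul_apply]
    have hmono : volume (Ioo (1 / 2 : ℝ) 1 • B) ≤ volume (Ioo (0 : ℝ) 1 • B) :=
      measure_mono (Set.smul_subset_smul_right (Ioo_subset_Ioo_left (by norm_num)))
    rw [ENNReal.smul_def, smul_eq_mul]
    push_cast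
    gcongr
  calc μH[2] B ≤ _ := hproj
    _ ≤ (6 : ℝ≥0∞) ^ (2 : ℝ) * (2 * ((4 : ℝ≥0∞) ^ (3 : ℝ) * (c * volume (Ioo (0 : ℝ) 1 • B)))) := by
        gcongr; exact hcylinder.trans (by gcongr)
    _ = _ := by ring

/-- The surface measure on the unit sphere induced by Lebesgue measure in polar coordinates. -/
abbrev sphereMeasure : Measure (Metric.sphere (0 : E3) 1) := (volume : Measure E3).toSphere

open scoped Pointwise in
lemma exists_hausdorffMeasure_restrict_sphere_le :
    ∃ K : ℝ≥0∞, K ≠ ∞ ∧ (μH[2] : Measure E3).restrict (Metric.sphere 0 1) ≤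
      K • sphereMeasure.map Subtype.val := by
  obtain ⟨K, hK, h⟩ := exists_hausdorffMeasure_cap_le
  refine ⟨6 * K, by finiteness, Measure.le_iff.2 fun A hA => ?_⟩
  rw [Measure.restrict_apply hA, Measure.smul_apply, Measure.map_apply measurable_subtype_coe hA,
    Measure.toSphere_apply' _ (measurable_subtype_coe hA), Subtype.image_preimage_coe, smul_eq_mul]
  set B := A ∩ Metric.sphere (0 : E3) 1 with hB
  have hBn : ∀ v ∈ B, ‖v‖ = 1 := fun v hv => by simpa using hv.2
  have hcover : B ⊆ (⋃ i : Fin 3, {v ∈ B | 1 / 2 ≤ 1 * v i}) ∪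
      ⋃ i : Fin 3, {v ∈ B | 1 / 2 ≤ (-1) * v i} := by
    intro v hv
    by_contra hcon
    simp only [mem_union, mem_iUnion, mem_ofPred_eq, not_or, not_exists, not_and, not_le] at hcon
    have hlt : ∀ i, v i ^ 2 < 1 / 3 := fun i => by
      have h1 := hcon.1 i hv
      have h2 := hcon.2 i hv
      nlinarith
    have hs := EuclideanSpace.real_norm_sq_eq v
    rw [hBn v hv, Fin.sum_univ_three] at hs
    linarith [hlt 0, hlt 1, hlt 2]
  have hcap : ∀ (e : ℝ), |e| = 1 → μH[2] (⋃ i : Fin 3, {v ∈ B | 1 / 2 ≤ e * v i}) ≤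
      3 * (K * volume (Ioo (0 : ℝ) 1 • B)) := fun e he => by
    refine (measure_iUnion_fintype_le _ _).trans ?_
    calc _ ≤ ∑ _i : Fin 3, K * volume (Ioo (0 : ℝ) 1 • B) := by
          refine Finset.sum_le_sum fun i _ => ?_
          refine (h i e he _ fun v hv => ⟨hBn v hv.1, hv.2⟩).trans ?_
          gcongr
          exact Set.sep_subset _ _
      _ = _ := by simp
  calc μH[2] B ≤ _ := measure_mono hcover
    _ ≤ _ := measure_union_le _ _
    _ ≤ 3 * (K * volume (Ioo (0 : ℝ) 1 • B)) + 3 * (K * volume (Ioo (0 : ℝ) 1 • B)) :=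
        add_le_add (hcap 1 (by simp)) (hcap (-1) (by simp))
    _ = 6 * K * (1 * volume (Ioo (0 : ℝ) 1 • B)) := by ring
    _ ≤ _ := by
        rw [inter_comm] at hB
        rw [← hB]
        gcongr
        simp

lemma exists_lintegral_sphere_le :
    ∃ K : ℝ≥0∞, K ≠ ∞ ∧ ∀ (x : E3) (r : ℝ), 0 < r → ∀ f : E3 → ℝ≥0∞, Measurable f →
      ∫⁻ y in Metric.sphere x r, f y ∂(μH[2]) ≤
        K * (ENNReal.ofReal (r ^ 2) * ∫⁻ ω, f (x + r • (ω : E3)) ∂sphereMeasure) := by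
  obtain ⟨K, hK, h⟩ := exists_hausdorffMeasure_restrict_sphere_le
  refine ⟨K, hK, fun x r hr f hf => ?_⟩
  let g : E3 → E3 := fun v => x + r • v
  have hg : Measurable g := by fun_prop
  have hlip : LipschitzWith r.toNNReal g := LipschitzWith.of_dist_le_mul fun v w => by
    simp only [g, dist_add_left, dist_smul₀, Real.norm_of_nonneg hr.le, Real.coe_toNNReal r hr.le]
    exact le_rfl
  have hle : (μH[2] : Measure E3).restrict (Metric.sphere x r) ≤
      ENNReal.ofReal (r ^ 2) • ((μH[2] : Measure E3).restrict (Metric.sphere 0 1)).map g := by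
    refine Measure.le_iff.2 fun A hA => ?_
    rw [Measure.restrict_apply hA, Measure.smul_apply, Measure.map_apply hg hA,
      Measure.restrict_apply (hg hA), smul_eq_mul]
    have hsub : A ∩ Metric.sphere x r ⊆ g '' (g ⁻¹' A ∩ Metric.sphere 0 1) := by
      rintro y ⟨hyA, hy⟩
      have hgy : g (r⁻¹ • (y - x)) = y := by simp [g, hr.ne']
      refine ⟨r⁻¹ • (y - x), ⟨by rwa [mem_preimage, hgy], ?_⟩, hgy⟩
      rw [mem_sphere_iff_norm] at hy
      rw [mem_sphere_zero_iff_norm, norm_smul, hy, norm_inv, Real.norm_of_nonneg hr.le,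
        inv_mul_cancel₀ hr.ne']
    refine (measure_mono hsub).trans ((hlip.hausdorffMeasure_image_le (by norm_num) _).trans ?_)
    rw [ENNReal.ofReal_pow hr.le]
    refine le_of_eq ?_
    congr 1
    exact ENNReal.rpow_natCast (ENNReal.ofReal r) 2
  calc ∫⁻ y in Metric.sphere x r, f y ∂(μH[2])
      ≤ ∫⁻ y, f y ∂(ENNReal.ofReal (r ^ 2) •
          ((μH[2] : Measure E3).restrict (Metric.sphere 0 1)).map g) := lintegral_mono' hle le_rfl
    _ = ENNReal.ofReal (r ^ 2) * ∫⁻ v in Metric.sphere 0 1, f (g v) ∂(μH[2]) := by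
        rw [lintegral_smul_measure, lintegral_map hf hg, smul_eq_mul]
    _ ≤ ENNReal.ofReal (r ^ 2) *
          ∫⁻ v, f (g v) ∂(K • sphereMeasure.map Subtype.val) := by
        gcongr
    _ = _ := by
        rw [lintegral_smul_measure, smul_eq_mul,
          lintegral_map (f := fun v => f (g v)) (hf.comp hg) measurable_subtype_coe]
        simp only [g]
        ring

lemma lintegral_polar {f : E3 → ℝ≥0∞} (hf : Measurable f) (x : E3) :
    ∫⁻ y, f y = ∫⁻ r in Ioi (0 : ℝ), ∫⁻ ω, ENNReal.ofReal (r ^ 2) * f (x + r • (ω : E3))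
      ∂sphereMeasure := by
  have hmp := (volume : Measure E3).measurePreserving_homeomorphUnitSphereProd
  have hfx : Measurable fun y => f (x + y) := hf.comp (measurable_const_add x)
  have h1 : ∫⁻ y, f y = ∫⁻ y : ({0}ᶜ : Set E3), f (x + y) ∂(volume.comap Subtype.val) := by
    rw [lintegral_subtype_comap (measurableSet_singleton (0 : E3)).compl fun y => f (x + y),
      restrict_compl_singleton, lintegral_add_left_eq_self]
  have h2 : Measurable fun p : Metric.sphere (0 : E3) 1 × Ioi (0 : ℝ) =>
      f (x + (p.2 : ℝ) • (p.1 : E3)) := hf.comp (by fun_prop)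
  have h3 : ∫⁻ y : ({0}ᶜ : Set E3), f (x + y) ∂(volume.comap Subtype.val) =
      ∫⁻ p, f (x + (p.2 : ℝ) • (p.1 : E3))
        ∂(sphereMeasure.prod (Measure.volumeIoiPow (Module.finrank ℝ E3 - 1))) := by
    rw [← hmp.lintegral_comp h2]
    refine lintegral_congr fun y => ?_
    congr 2
    have hy : ‖(y : E3)‖ ≠ 0 := norm_ne_zero_iff.2 y.2
    simp [smul_smul, mul_inv_cancel₀ hy]
  have hr2 : Measurable fun r : Ioi (0 : ℝ) => ENNReal.ofReal ((r : ℝ) ^ 2) := by fun_prop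
  rw [h1, h3, lintegral_prod_symm' _ h2]
  simp only [finrank_euclideanSpace, Fintype.card_fin, Measure.volumeIoiPow,
    show (3 - 1 : ℕ) = 2 from rfl]
  rw [lintegral_withDensity_eq_lintegral_mul _ hr2 h2.lintegral_prod_left']
  simp only [Pi.mul_apply]
  rw [← lintegral_subtype_comap measurableSet_Ioi]
  refine lintegral_congr fun r => ?_
  rw [lintegral_const_mul]
  exact hf.comp (by fun_prop)

/-- The derivative of `u`, as a function of space-time, in the direction `v`. -/
def dirDeriv (u : ℝ → E3 → ℝ) (v : ℝ × E3) (z : ℝ × E3) : ℝ := fderiv ℝ (uncurry u) z v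

/-- The `i`-th spatial unit vector of space-time. -/
abbrev spaceDir (i : Fin 3) : ℝ × E3 := (0, EuclideanSpace.single i 1)

/-- The energy density of `u`. -/
def energyDensity (u : ℝ → E3 → ℝ) (z : ℝ × E3) : ℝ :=
  (1 / 2) * dirDeriv u (1, 0) z ^ 2 + (1 / 2) * ∑ i, dirDeriv u (spaceDir i) z ^ 2
    + (1 / 6) * uncurry u z ^ 6

lemma energyDensity_nonneg (u : ℝ → E3 → ℝ) (z : ℝ × E3) : 0 ≤ energyDensity u z := by
  unfold energyDensity; positivity

section Solution

variable {u : ℝ → E3 → ℝ}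

lemma IsNLW.contDiff (hu : IsNLW u) : ContDiff ℝ (⊤ : ℕ∞) (uncurry u) := by
  simpa [univ_prod_univ, contDiffOn_univ] using hu.1

lemma IsNLW.contDiff_dirDeriv (hu : IsNLW u) (v : ℝ × E3) :
    ContDiff ℝ (⊤ : ℕ∞) (dirDeriv u v) :=
  (hu.contDiff.fderiv_right (m := (⊤ : ℕ∞)) (by simp)).clm_apply contDiff_const

lemma IsNLW.contDiff_energyDensity (hu : IsNLW u) : ContDiff ℝ (⊤ : ℕ∞) (energyDensity u) := by
  have h0 := hu.contDiff_dirDeriv (1, 0)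
  have hi := fun i => hu.contDiff_dirDeriv (spaceDir i)
  have := hu.contDiff
  unfold energyDensity
  fun_prop

lemma fderiv_slice_time {f : ℝ × E3 → ℝ} (hf : Differentiable ℝ f) (t : ℝ) (x : E3) :
    HasDerivAt (fun s => f (s, x)) (fderiv ℝ f (t, x) (1, 0)) t := by
  have h : HasDerivAt (fun s : ℝ => (s, x)) ((1 : ℝ), (0 : E3)) t :=
    (hasDerivAt_id t).prodMk (hasDerivAt_const t x)
  exact (hf (t, x)).hasFDerivAt.comp_hasDerivAt t h

lemma fderiv_slice_space {f : ℝ × E3 → ℝ} (hf : Differentiable ℝ f) (t : ℝ) (x v : E3) :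
    fderiv ℝ (fun y => f (t, y)) x v = fderiv ℝ f (t, x) (0, v) := by
  have h := (hf (t, x)).hasFDerivAt.comp x (hasFDerivAt_prodMk_right (𝕜 := ℝ) t x)
  rw [show (fun y => f (t, y)) = f ∘ Prod.mk t from rfl, h.fderiv]
  simp

lemma IsNLW.tderiv_eq (hu : IsNLW u) (t : ℝ) (x : E3) :
    tderiv u t x = dirDeriv u (1, 0) (t, x) :=
  (fderiv_slice_time (hu.contDiff.differentiable (by simp)) t x).deriv

lemma IsNLW.tderiv2_eq (hu : IsNLW u) (t : ℝ) (x : E3) :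
    tderiv2 u t x = fderiv ℝ (dirDeriv u (1, 0)) (t, x) (1, 0) := by
  unfold tderiv2
  simp_rw [hu.tderiv_eq]
  exact (fderiv_slice_time ((hu.contDiff_dirDeriv _).differentiable (by simp)) t x).deriv

lemma IsNLW.fderiv_space_eq (hu : IsNLW u) (t : ℝ) (x v : E3) :
    fderiv ℝ (u t) x v = dirDeriv u (0, v) (t, x) :=
  fderiv_slice_space (hu.contDiff.differentiable (by simp)) t x v

lemma IsNLW.contDiff_slice (hu : IsNLW u) (t : ℝ) : ContDiff ℝ (⊤ : ℕ∞) (u t) :=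
  hu.contDiff.comp (contDiff_prodMk_right t)

lemma IsNLW.lap_eq (hu : IsNLW u) (t : ℝ) (x : E3) :
    lap (u t) x = ∑ i, fderiv ℝ (dirDeriv u (spaceDir i)) (t, x) (spaceDir i) := by
  unfold lap
  refine Finset.sum_congr rfl fun i _ => ?_
  set e : E3 := EuclideanSpace.single i 1
  have hd : DifferentiableAt ℝ (fderiv ℝ (u t)) x :=
    ((hu.contDiff_slice t).fderiv_right (m := (⊤ : ℕ∞)) (by simp)).differentiable (by simp) x
  rw [iteratedFDeriv_two_apply]
  have h1 : fderiv ℝ (fderiv ℝ (u t)) x e e = fderiv ℝ (fun y => fderiv ℝ (u t) y e) x e := by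
    rw [fderiv_clm_apply hd (differentiableAt_const e)]
    simp
  simp only [Matrix.cons_val_zero, Matrix.cons_val_one]
  rw [h1]
  simp_rw [hu.fderiv_space_eq]
  exact fderiv_slice_space ((hu.contDiff_dirDeriv _).differentiable (by simp)) t x e

lemma IsNLW.fderiv_dirDeriv_comm (hu : IsNLW u) (v w z : ℝ × E3) :
    fderiv ℝ (dirDeriv u v) z w = fderiv ℝ (dirDeriv u w) z v := by
  have hd : DifferentiableAt ℝ (fderiv ℝ (uncurry u)) z :=
    (hu.contDiff.fderiv_right (m := (⊤ : ℕ∞)) (by simp)).differentiable (by simp) z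
  have h : ∀ a b : ℝ × E3, fderiv ℝ (dirDeriv u a) z b = fderiv ℝ (fderiv ℝ (uncurry u)) z b a :=
    fun a b => by
      unfold dirDeriv
      rw [fderiv_clm_apply hd (differentiableAt_const a)]
      simp
  rw [h, h]
  exact (hu.contDiff.contDiffAt.isSymmSndFDerivAt (by
    rw [minSmoothness_of_isRCLikeNormedField]
    exact WithTop.coe_le_coe.2 (le_top : (2 : ℕ∞) ≤ ⊤))).eq _ _

lemma IsNLW.fderiv_energyDensity_time (hu : IsNLW u) (z : ℝ × E3) :
    fderiv ℝ (energyDensity u) z (1, 0) =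
      ∑ i, fderiv ℝ (fun z => dirDeriv u (1, 0) z * dirDeriv u (spaceDir i) z) z (spaceDir i) := by
  have hd : ∀ v, HasFDerivAt (dirDeriv u v) (fderiv ℝ (dirDeriv u v) z) z := fun v =>
    ((hu.contDiff_dirDeriv v).differentiable (by simp) z).hasFDerivAt
  have hU : HasFDerivAt (uncurry u) (fderiv ℝ (uncurry u) z) z :=
    (hu.contDiff.differentiable (by simp) z).hasFDerivAt
  have he := ((((hd (1, 0)).pow 2).const_mul (1 / 2)).add
    ((HasFDerivAt.fun_sum (u := Finset.univ) fun i _ => (hd (spaceDir i)).pow 2).const_mul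
      (1 / 2))).add ((hU.pow 6).const_mul (1 / 6))
  have hf := fun i => (hd (1, 0)).mul (hd (spaceDir i))
  have heq := hu.2.2 z.1 (mem_univ _) z.2
  rw [hu.tderiv2_eq, hu.lap_eq] at heq
  have h0 : fderiv ℝ (uncurry u) z (1, 0) = dirDeriv u (1, 0) z := rfl
  have e1 : fderiv ℝ (energyDensity u) z (1, 0) = _ := congrArg (fun L => L (1, 0)) he.fderiv
  have e2 : ∀ i, fderiv ℝ (fun z => dirDeriv u (1, 0) z * dirDeriv u (spaceDir i) z) z
      (spaceDir i) = _ := fun i => congrArg (fun L => L (spaceDir i)) (hf i).fderiv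
  rw [e1]
  simp_rw [e2]
  simp only [add_apply, smul_apply, smul_eq_mul, h0, Fin.sum_univ_three, nsmul_eq_mul,
    hu.fderiv_dirDeriv_comm (spaceDir _) (1, 0)] at heq ⊢
  change fderiv ℝ (dirDeriv u (1, 0)) z (1, 0) - _ + uncurry u z ^ 5 = 0 at heq
  simp only [Prod.mk.eta] at heq
  have h1 := eq_sub_of_add_eq heq
  push_cast
  linear_combination (dirDeriv u (1, 0) z) * heq

lemma IsSchwartz.exists_schwartzMap {f : E3 → ℝ} (hf : IsSchwartz f) :
    ∃ g : SchwartzMap E3 ℝ, ⇑g = f :=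
  ⟨⟨f, hf.1, hf.2⟩, rfl⟩

lemma IsSchwartz.integrable_pow {f : E3 → ℝ} (hf : IsSchwartz f) {n : ℕ} (hn : n ≠ 0)
    (hn2 : Even n) : Integrable fun x => f x ^ n := by
  obtain ⟨g, rfl⟩ := hf.exists_schwartzMap
  simpa [hn2.pow_abs] using (g.memLp n volume).integrable_norm_pow hn

lemma IsSchwartz.integrable_norm_fderiv_sq {f : E3 → ℝ} (hf : IsSchwartz f) (v : E3) :
    Integrable fun x => fderiv ℝ f x v ^ 2 := by
  obtain ⟨g, rfl⟩ := hf.exists_schwartzMap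
  simpa [SchwartzMap.lineDerivOp_apply_eq_fderiv] using ((LineDeriv.lineDerivOp v g).memLp 2 volume).integrable_norm_pow two_ne_zero

lemma norm_gradient_sq (f : E3 → ℝ) (x : E3) :
    ‖gradient f x‖ ^ 2 = ∑ i, fderiv ℝ f x (EuclideanSpace.single i 1) ^ 2 := by
  rw [EuclideanSpace.real_norm_sq_eq]
  refine Finset.sum_congr rfl fun i _ => ?_
  have h : inner ℝ (gradient f x) (EuclideanSpace.single i (1 : ℝ))
      = fderiv ℝ f x (EuclideanSpace.single i 1) := by
    rw [gradient, InnerProductSpace.toDual_symm_apply]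
  rw [← h, EuclideanSpace.inner_single_right]
  simp

lemma IsNLW.energy_eq (hu : IsNLW u) (t : ℝ) : energy u t = ∫ x, energyDensity u (t, x) := by
  unfold energy energyDensity
  simp only [norm_gradient_sq, hu.tderiv_eq, hu.fderiv_space_eq, uncurry]

lemma IsNLW.integrable_energyDensity (hu : IsNLW u) (t : ℝ) :
    Integrable fun x => energyDensity u (t, x) := by
  obtain ⟨h1, h2⟩ := hu.2.1 t (mem_univ t)
  have hp := h2.integrable_pow two_ne_zero even_two
  have hq := fun i : Fin 3 => h1.integrable_norm_fderiv_sq (EuclideanSpace.single i 1)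
  have hU := h1.integrable_pow (n := 6) (by norm_num) (by decide)
  simp only [hu.tderiv_eq, hu.fderiv_space_eq] at hp hq
  exact ((hp.const_mul _).add ((integrable_finsetSum _ fun i _ => hq i).const_mul _)).add
    (hU.const_mul _)

lemma IsNLW.energy_nonneg (hu : IsNLW u) (t : ℝ) : 0 ≤ energy u t := by
  rw [hu.energy_eq]
  exact integral_nonneg fun x => energyDensity_nonneg u _

/-- A smooth nonincreasing profile equal to `1` on `(-∞, a]` and to `0` on `[b, ∞)`. -/
structure IsCutoff (φ : ℝ → ℝ) (a b : ℝ) : Prop where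
  contDiff : ContDiff ℝ (⊤ : ℕ∞) φ
  antitone : Antitone φ
  eq_one : ∀ p ≤ a, φ p = 1
  eq_zero : ∀ p, b ≤ p → φ p = 0

namespace IsCutoff

variable {φ : ℝ → ℝ} {a b : ℝ}

lemma exists_of_lt (hab : a < b) : ∃ φ, IsCutoff φ a b := by
  have hba : 0 < b - a := sub_pos.2 hab
  refine ⟨fun p => smoothTransition ((b - p) / (b - a)), ?_, fun p q hpq => ?_, fun p hp => ?_,
    fun p hp => ?_⟩
  · exact smoothTransition.contDiff.comp (by fun_prop)
  · exact smoothTransition.monotone (by gcongr)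
  · exact smoothTransition.one_of_one_le ((one_le_div hba).2 (by linarith))
  · exact smoothTransition.zero_of_nonpos (div_nonpos_of_nonpos_of_nonneg (by linarith) hba.le)

lemma continuous_deriv (h : IsCutoff φ a b) : Continuous (deriv φ) :=
  h.contDiff.continuous_deriv (by simp)

lemma deriv_nonpos (h : IsCutoff φ a b) (p : ℝ) : deriv φ p ≤ 0 := h.antitone.deriv_nonpos

lemma nonneg (h : IsCutoff φ a b) (p : ℝ) : 0 ≤ φ p := by
  rw [← h.eq_zero (max p b) (le_max_right _ _)]
  exact h.antitone (le_max_left _ _)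

lemma le_one (h : IsCutoff φ a b) (p : ℝ) : φ p ≤ 1 := by
  rw [← h.eq_one (min p a) (min_le_right _ _)]
  exact h.antitone (min_le_left _ _)

lemma deriv_eq_zero (h : IsCutoff φ a b) {p : ℝ} (hp : b < p) : deriv φ p = 0 := by
  have : φ =ᶠ[nhds p] fun _ => 0 := by
    filter_upwards [lt_mem_nhds hp] with q hq using h.eq_zero q hq.le
  rw [this.deriv_eq, deriv_const]

variable {τ : ℝ} (x : E3)

lemma radial_eventuallyEq (h : IsCutoff φ a b) (hτ : τ < a) :
    (fun y : E3 => φ (τ + ‖y - x‖)) =ᶠ[nhds x] fun _ => 1 := by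
  have hc : ContinuousAt (fun y : E3 => τ + ‖y - x‖) x := by fun_prop
  filter_upwards [hc.eventually_lt (g := fun _ => a) continuousAt_const (by simpa using hτ)] with y hy
  exact h.eq_one _ hy.le

lemma contDiff_radial (h : IsCutoff φ a b) (hτ : τ < a) :
    ContDiff ℝ 1 fun y : E3 => φ (τ + ‖y - x‖) := by
  refine contDiff_iff_contDiffAt.2 fun y => ?_
  rcases eq_or_ne y x with rfl | hy
  · exact contDiffAt_const.congr_of_eventuallyEq (h.radial_eventuallyEq y hτ)
  · have hn : ContDiffAt ℝ 1 (fun y : E3 => ‖y - x‖) y :=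
      (contDiffAt_id.sub contDiffAt_const).norm ℝ (sub_ne_zero.2 hy)
    exact (h.contDiff.of_le (by simp)).contDiffAt.comp y (contDiffAt_const.add hn)

lemma norm_fderiv_radial_le (h : IsCutoff φ a b) (hτ : τ < a) (y : E3) :
    ‖fderiv ℝ (fun y : E3 => φ (τ + ‖y - x‖)) y‖ ≤ -deriv φ (τ + ‖y - x‖) := by
  rcases eq_or_ne y x with rfl | hy
  · rw [(h.radial_eventuallyEq y hτ).fderiv_eq]
    simpa using h.deriv_nonpos _
  · have hn : DifferentiableAt ℝ (fun y : E3 => τ + ‖y - x‖) y :=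
      (differentiableAt_const _).add
        ((differentiableAt_id.sub (differentiableAt_const _)).norm ℝ (sub_ne_zero.2 hy))
    have hφ : DifferentiableAt ℝ φ (τ + ‖y - x‖) := h.contDiff.differentiable (by simp) _
    have hc := (hφ.hasDerivAt.comp_hasFDerivAt y hn.hasFDerivAt).fderiv
    have hl : LipschitzWith 1 fun y : E3 => τ + ‖y - x‖ := LipschitzWith.of_dist_le_mul
      fun v w => by
        rw [dist_add_left, NNReal.coe_one, one_mul, Real.dist_eq, dist_eq_norm]
        simpa using abs_norm_sub_norm_le (v - x) (w - x)
    have h1 := norm_fderiv_le_of_lipschitz ℝ hl (x₀ := y)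
    rw [show (fun y : E3 => φ (τ + ‖y - x‖)) = φ ∘ fun y => τ + ‖y - x‖ from rfl, hc, norm_smul,
      Real.norm_of_nonpos (h.deriv_nonpos _)]
    exact mul_le_of_le_one_right (neg_nonneg.2 (h.deriv_nonpos _)) (by simpa using h1)

lemma hasCompactSupport_radial {f : ℝ → ℝ} (hf : ∀ p, b < p → f p = 0) (hτ : 0 ≤ τ) :
    HasCompactSupport fun y : E3 => f (τ + ‖y - x‖) := by
  refine HasCompactSupport.intro (isCompact_closedBall x b) fun y hy => hf _ ?_
  rw [Metric.mem_closedBall, dist_eq_norm, not_le] at hy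
  linarith

end IsCutoff

lemma IsNLW.integral_cutoff_le (hu : IsNLW u) {φ : ℝ → ℝ} {a b τ : ℝ} (h : IsCutoff φ a b)
    (hτ0 : 0 ≤ τ) (hτ : τ < a) (x : E3) :
    ∫ y, (fderiv ℝ (energyDensity u) (τ, y) (1, 0) * φ (τ + ‖y - x‖)
      + energyDensity u (τ, y) * deriv φ (τ + ‖y - x‖)) ≤
    ∫ y, (1 / 6) * (deriv φ (τ + ‖y - x‖) * u τ y ^ 6) := by
  set Φ : E3 → ℝ := fun y => φ (τ + ‖y - x‖) with hΦ
  set ψ : E3 → ℝ := fun y => deriv φ (τ + ‖y - x‖) with hψ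
  have hΦc : ContDiff ℝ 1 Φ := h.contDiff_radial x hτ
  have hΦs : HasCompactSupport Φ :=
    IsCutoff.hasCompactSupport_radial x (fun p hp => h.eq_zero p hp.le) hτ0
  have hψs : HasCompactSupport ψ :=
    IsCutoff.hasCompactSupport_radial x (fun p hp => h.deriv_eq_zero hp) hτ0
  have hψc : Continuous ψ := h.continuous_deriv.comp (by fun_prop)
  have hec : Continuous fun y => energyDensity u (τ, y) :=
    hu.contDiff_energyDensity.continuous.comp (by fun_prop)
  have hUc : Continuous (u τ) := (hu.contDiff_slice τ).continuous
  let p : E3 → ℝ := fun y => dirDeriv u (1, 0) (τ, y)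
  let q : Fin 3 → E3 → ℝ := fun i y => dirDeriv u (spaceDir i) (τ, y)
  have hpc : Continuous p := (hu.contDiff_dirDeriv _).continuous.comp (by fun_prop)
  have hqc : ∀ i, Continuous (q i) := fun i =>
    (hu.contDiff_dirDeriv _).continuous.comp (by fun_prop)
  have hflux : ∀ i, ContDiff ℝ (⊤ : ℕ∞) fun y => p y * q i y := fun i =>
    ((hu.contDiff_dirDeriv _).mul (hu.contDiff_dirDeriv _)).comp (contDiff_prodMk_right τ)
  have hfc : ∀ i, Continuous fun y => fderiv ℝ (fun y => p y * q i y) y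
      (EuclideanSpace.single i 1) := fun i =>
    ((hflux i).continuous_fderiv (by simp)).clm_apply continuous_const
  have hΦd : ∀ i : Fin 3, Continuous fun y => fderiv ℝ Φ y (EuclideanSpace.single i 1) := fun i =>
    (hΦc.continuous_fderiv (by simp)).clm_apply continuous_const
  have hΦds : ∀ i : Fin 3, HasCompactSupport fun y => fderiv ℝ Φ y (EuclideanSpace.single i 1) :=
    fun i => hΦs.fderiv_apply ℝ _
  have hdiv : ∀ y, fderiv ℝ (energyDensity u) (τ, y) (1, 0) =
      ∑ i, fderiv ℝ (fun y => p y * q i y) y (EuclideanSpace.single i 1) := fun y => by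
    rw [hu.fderiv_energyDensity_time]
    refine Finset.sum_congr rfl fun i _ => (fderiv_slice_space (f := fun z =>
      dirDeriv u (1, 0) z * dirDeriv u (spaceDir i) z) ?_ τ y _).symm
    exact ((hu.contDiff_dirDeriv _).mul (hu.contDiff_dirDeriv _)).differentiable (by simp)
  have hI1 : ∀ i, Integrable fun y => Φ y * fderiv ℝ (fun y => p y * q i y) y
      (EuclideanSpace.single i 1) := fun i =>
    (hΦc.continuous.mul (hfc i)).integrable_of_hasCompactSupport hΦs.mul_right
  have hI2 : ∀ i, Integrable fun y => fderiv ℝ Φ y (EuclideanSpace.single i 1) *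
      (p y * q i y) := fun i =>
    ((hΦd i).mul (hflux i).continuous).integrable_of_hasCompactSupport (hΦds i).mul_right
  have hibp : ∀ i, ∫ y, Φ y * fderiv ℝ (fun y => p y * q i y) y (EuclideanSpace.single i 1) =
      - ∫ y, fderiv ℝ Φ y (EuclideanSpace.single i 1) * (p y * q i y) := fun i =>
    integral_mul_fderiv_eq_neg_fderiv_mul_of_integrable (hI2 i) (hI1 i)
      ((hΦc.continuous.mul (hflux i).continuous).integrable_of_hasCompactSupport hΦs.mul_right)
      (fun y _ => hΦc.differentiable (by simp) y)
      (fun y _ => (hflux i).differentiable (by simp) y)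
  have hI3 : Integrable fun y => energyDensity u (τ, y) * ψ y :=
    (hec.mul hψc).integrable_of_hasCompactSupport hψs.mul_left
  have hI4 : Integrable fun y => (1 / 6) * (ψ y * u τ y ^ 6) :=
    ((hψc.mul (hUc.pow 6)).integrable_of_hasCompactSupport hψs.mul_right).const_mul _
  have hI5 : Integrable fun y => ∑ i, fderiv ℝ Φ y (EuclideanSpace.single i 1) * (p y * q i y) :=
    integrable_finsetSum _ fun i _ => hI2 i
  have hI5n : Integrable fun y =>
      -∑ i, fderiv ℝ Φ y (EuclideanSpace.single i 1) * (p y * q i y) := hI5.neg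
  have hkey : ∫ y, fderiv ℝ (energyDensity u) (τ, y) (1, 0) * Φ y =
      - ∫ y, ∑ i, fderiv ℝ Φ y (EuclideanSpace.single i 1) * (p y * q i y) := by
    simp_rw [hdiv, Finset.sum_mul, mul_comm _ (Φ _)]
    rw [integral_finsetSum _ fun i _ => hI1 i, integral_finsetSum _ fun i _ => hI2 i,
      ← Finset.sum_neg_distrib]
    exact Finset.sum_congr rfl fun i _ => hibp i
  have hI6 : Integrable fun y => fderiv ℝ (energyDensity u) (τ, y) (1, 0) * Φ y := by
    simp_rw [hdiv, Finset.sum_mul, mul_comm _ (Φ _)]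
    exact integrable_finsetSum _ fun i _ => hI1 i
  rw [integral_add hI6 hI3, hkey, ← integral_neg, ← integral_add hI5n hI3]
  refine integral_mono (hI5n.add hI3) hI4 fun y => ?_
  let V : E3 := WithLp.toLp 2 fun i => q i y
  have hV : V = ∑ i, q i y • EuclideanSpace.single i (1 : ℝ) := by
    ext j
    simp only [V, Fin.sum_univ_three]
    fin_cases j <;> simp
  have hVn : ‖V‖ ^ 2 = ∑ i, q i y ^ 2 := EuclideanSpace.real_norm_sq_eq V
  have hsum : ∑ i, fderiv ℝ Φ y (EuclideanSpace.single i 1) * (p y * q i y) =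
      p y * fderiv ℝ Φ y V := by
    rw [hV, map_sum, Finset.mul_sum]
    refine Finset.sum_congr rfl fun i _ => ?_
    rw [map_smul, smul_eq_mul]; ring
  have hL : |fderiv ℝ Φ y V| ≤ -ψ y * ‖V‖ :=
    ((fderiv ℝ Φ y).le_opNorm V).trans
      (mul_le_mul_of_nonneg_right (h.norm_fderiv_radial_le x hτ y) (norm_nonneg _))
  have hψ0 : ψ y ≤ 0 := h.deriv_nonpos _
  have hdens : energyDensity u (τ, y) = 1 / 2 * p y ^ 2 + 1 / 2 * ‖V‖ ^ 2 + 1 / 6 * u τ y ^ 6 := by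
    rw [hVn]; rfl
  have hbound : -(p y * fderiv ℝ Φ y V) ≤ -ψ y * (1 / 2 * p y ^ 2 + 1 / 2 * ‖V‖ ^ 2) := by
    calc -(p y * fderiv ℝ Φ y V) ≤ |p y * fderiv ℝ Φ y V| := neg_le_abs _
      _ = |p y| * |fderiv ℝ Φ y V| := abs_mul _ _
      _ ≤ |p y| * (-ψ y * ‖V‖) := by gcongr
      _ = -ψ y * (|p y| * ‖V‖) := by ring
      _ ≤ _ := by
          refine mul_le_mul_of_nonneg_left ?_ (by linarith)
          rw [← sq_abs (p y)]
          nlinarith [sq_nonneg (|p y| - ‖V‖)]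
  change -(∑ i, fderiv ℝ Φ y (EuclideanSpace.single i 1) * (p y * q i y)) +
    energyDensity u (τ, y) * ψ y ≤ 1 / 6 * (ψ y * u τ y ^ 6)
  rw [hsum, hdens]
  linarith

lemma IsNLW.setIntegral_cutoff_le (hu : IsNLW u) {φ : ℝ → ℝ} {a b s E : ℝ} (h : IsCutoff φ a b)
    (hE : ∀ t, energy u t ≤ E) (hs : 0 ≤ s) (hsa : s < a) (x : E3) :
    ∫ τ in Icc 0 s, ∫ y in Metric.closedBall x b, -deriv φ (τ + ‖y - x‖) * u τ y ^ 6 ≤ 6 * E := by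
  set B := Metric.closedBall x b
  have hB : MeasurableSet B := Metric.isClosed_closedBall.measurableSet
  have hφd : ∀ p, HasDerivAt φ (deriv φ p) p := fun p =>
    (h.contDiff.differentiable (by simp) p).hasDerivAt
  let H : ℝ → E3 → ℝ := fun τ y => fderiv ℝ (energyDensity u) (τ, y) (1, 0) * φ (τ + ‖y - x‖)
      + energyDensity u (τ, y) * deriv φ (τ + ‖y - x‖)
  let W : ℝ → E3 → ℝ := fun τ y => -deriv φ (τ + ‖y - x‖) * u τ y ^ 6
  have hφc := h.contDiff.continuous
  have hψc := h.continuous_deriv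
  have hec := hu.contDiff_energyDensity.continuous
  have hUc := hu.contDiff.continuous
  have hedc : Continuous fun z => fderiv ℝ (energyDensity u) z (1, 0) :=
    (hu.contDiff_energyDensity.continuous_fderiv (by simp)).clm_apply continuous_const
  have hHc : Continuous (uncurry H) := by
    change Continuous fun z : ℝ × E3 => fderiv ℝ (energyDensity u) z (1, 0) * φ (z.1 + ‖z.2 - x‖)
      + energyDensity u z * deriv φ (z.1 + ‖z.2 - x‖)
    fun_prop
  have hWc : Continuous (uncurry W) := by
    change Continuous fun z : ℝ × E3 => -deriv φ (z.1 + ‖z.2 - x‖) * uncurry u z ^ 6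
    fun_prop
  have hint : ∀ F : ℝ × E3 → ℝ, Continuous F →
      Integrable F ((volume.restrict (Icc 0 s)).prod (volume.restrict B)) := fun F hF => by
    rw [Measure.prod_restrict]
    exact hF.continuousOn.integrableOn_compact (isCompact_Icc.prod (isCompact_closedBall x b))
  have hout : ∀ τ, 0 ≤ τ → ∀ y, y ∉ B → b < τ + ‖y - x‖ := fun τ hτ y hy => by
    rw [Metric.mem_closedBall, dist_eq_norm, not_le] at hy
    linarith
  have hslice : ∀ τ ∈ Icc 0 s, ∫ y in B, H τ y ≤ ∫ y in B, -(1 / 6) * W τ y := fun τ hτ => by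
    rw [setIntegral_eq_integral_of_forall_compl_eq_zero fun y hy => ?_,
      setIntegral_eq_integral_of_forall_compl_eq_zero fun y hy => ?_]
    · refine (hu.integral_cutoff_le h hτ.1 (hτ.2.trans_lt hsa) x).trans_eq ?_
      refine integral_congr_ae (.of_forall fun y => ?_)
      simp only [W]; ring
    · simp [W, h.deriv_eq_zero (hout τ hτ.1 y hy)]
    · simp [H, h.deriv_eq_zero (hout τ hτ.1 y hy), h.eq_zero _ (hout τ hτ.1 y hy).le]
  have hmono : ∫ τ in Icc 0 s, ∫ y in B, H τ y ≤ ∫ τ in Icc 0 s, ∫ y in B, -(1 / 6) * W τ y :=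
    setIntegral_mono_on (hint _ hHc).integral_prod_left
      (hint _ (continuous_const.mul hWc)).integral_prod_left measurableSet_Icc hslice
  have hswap : ∫ τ in Icc 0 s, ∫ y in B, H τ y = ∫ y in B, ∫ τ in Icc 0 s, H τ y :=
    integral_integral_swap (hint _ hHc)
  have hftc : ∀ y, ∫ τ in Icc 0 s, H τ y =
      energyDensity u (s, y) * φ (s + ‖y - x‖) - energyDensity u (0, y) * φ (0 + ‖y - x‖) :=
    fun y => by
      rw [integral_Icc_eq_integral_Ioc, ← intervalIntegral.integral_of_le hs]
      have hHy : Continuous fun τ => H τ y :=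
        hHc.comp (by fun_prop : Continuous fun τ : ℝ => (τ, y))
      refine intervalIntegral.integral_eq_sub_of_hasDerivAt
        (f := fun τ => energyDensity u (τ, y) * φ (τ + ‖y - x‖)) (fun τ _ => ?_)
        (hHy.intervalIntegrable _ _)
      exact (fderiv_slice_time (hu.contDiff_energyDensity.differentiable (by simp)) τ y).mul
        ((hφd _).comp_add_const τ ‖y - x‖)
  have hlow : -E ≤ ∫ y in B, ∫ τ in Icc 0 s, H τ y := by
    have hei := (hu.integrable_energyDensity 0).integrableOn (s := B)
    calc -E ≤ -∫ y, energyDensity u (0, y) := by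
          rw [← hu.energy_eq]; exact neg_le_neg (hE 0)
      _ ≤ -∫ y in B, energyDensity u (0, y) :=
          neg_le_neg (setIntegral_le_integral (hu.integrable_energyDensity 0)
            (.of_forall fun y => energyDensity_nonneg u _))
      _ = ∫ y in B, -energyDensity u (0, y) := (integral_neg _).symm
      _ ≤ _ := by
          refine setIntegral_mono_on hei.neg (hint _ hHc).integral_prod_right hB fun y _ => ?_
          change _ ≤ ∫ τ in Icc 0 s, H τ y
          rw [hftc]
          have h1 := mul_nonneg (energyDensity_nonneg u (s, y)) (h.nonneg (s + ‖y - x‖))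
          have h2 := mul_le_of_le_one_right (energyDensity_nonneg u (0, y)) (h.le_one (0 + ‖y - x‖))
          linarith
  rw [hswap] at hmono
  simp_rw [integral_const_mul] at hmono
  change ∫ τ in Icc 0 s, ∫ y in B, W τ y ≤ 6 * E
  linarith

lemma IsNLW.lintegral_cutoff_le (hu : IsNLW u) {φ : ℝ → ℝ} {a b s E : ℝ} (h : IsCutoff φ a b)
    (hE : ∀ t, energy u t ≤ E) (hs : 0 ≤ s) (hsa : s < a) (x : E3) :
    ∫⁻ τ in Icc 0 s, ∫⁻ y, ENNReal.ofReal (-deriv φ (τ + ‖y - x‖) * u τ y ^ 6) ≤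
      ENNReal.ofReal (6 * E) := by
  set B := Metric.closedBall x b
  let W : ℝ × E3 → ℝ := fun z => -deriv φ (z.1 + ‖z.2 - x‖) * uncurry u z ^ 6
  have hWc : Continuous W := by
    have := h.continuous_deriv
    have := hu.contDiff.continuous
    fun_prop
  have hWi : Integrable W ((volume.restrict (Icc 0 s)).prod (volume.restrict B)) := by
    rw [Measure.prod_restrict]
    exact hWc.continuousOn.integrableOn_compact (isCompact_Icc.prod (isCompact_closedBall x b))
  have hW0 : ∀ z, 0 ≤ W z := fun z =>
    mul_nonneg (neg_nonneg.2 (h.deriv_nonpos _)) (Even.pow_nonneg (by decide) _)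
  have hball : ∀ τ ∈ Icc 0 s, ∫⁻ y, ENNReal.ofReal (W (τ, y)) =
      ∫⁻ y in B, ENNReal.ofReal (W (τ, y)) := fun τ hτ => by
    refine (setLIntegral_eq_of_support_subset fun y hy => ?_).symm
    by_contra hyB
    rw [Metric.mem_closedBall, dist_eq_norm, not_le] at hyB
    have hb : b < τ + ‖y - x‖ := by linarith [hτ.1]
    exact hy (by simp [W, h.deriv_eq_zero hb])
  calc ∫⁻ τ in Icc 0 s, ∫⁻ y, ENNReal.ofReal (W (τ, y))
      = ∫⁻ τ in Icc 0 s, ∫⁻ y in B, ENNReal.ofReal (W (τ, y)) :=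
        setLIntegral_congr_fun measurableSet_Icc hball
    _ = ∫⁻ z, ENNReal.ofReal (W z) ∂((volume.restrict (Icc 0 s)).prod (volume.restrict B)) :=
        (lintegral_prod _ hWc.measurable.ennreal_ofReal.aemeasurable).symm
    _ = ENNReal.ofReal (∫ z, W z ∂((volume.restrict (Icc 0 s)).prod (volume.restrict B))) :=
        (ofReal_integral_eq_lintegral_ofReal hWi (.of_forall hW0)).symm
    _ ≤ ENNReal.ofReal (6 * E) := by
        refine ENNReal.ofReal_le_ofReal ?_
        rw [integral_prod _ hWi]
        exact hu.setIntegral_cutoff_le h hE hs hsa x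

/-- The density of the flux of `u ^ 6` through the backward light cone with apex `(p, x)`, at
time `z.1` and in the direction `z.2`. -/
def fluxDensity (u : ℝ → E3 → ℝ) (x : E3) (p : ℝ) (z : ℝ × Metric.sphere (0 : E3) 1) : ℝ :=
  (p - z.1) ^ 2 * u z.1 (x + (p - z.1) • (z.2 : E3)) ^ 6

lemma fluxDensity_nonneg (x : E3) (p : ℝ) (z : ℝ × Metric.sphere (0 : E3) 1) :
    0 ≤ fluxDensity u x p z :=
  mul_nonneg (sq_nonneg _) (Even.pow_nonneg (by decide) _)

lemma IsNLW.continuous_fluxDensity (hu : IsNLW u) (x : E3) :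
    Continuous (uncurry (fluxDensity u x)) := by
  have hU := hu.contDiff.continuous
  change Continuous fun w : ℝ × ℝ × Metric.sphere (0 : E3) 1 => (w.1 - w.2.1) ^ 2 *
    uncurry u (w.2.1, x + (w.1 - w.2.1) • (w.2.2 : E3)) ^ 6
  fun_prop

lemma IsNLW.lintegral_fluxDensity_mul_le (hu : IsNLW u) {φ : ℝ → ℝ} {a b s E : ℝ}
    (h : IsCutoff φ a b) (hE : ∀ t, energy u t ≤ E) (hs : 0 ≤ s) (hsa : s < a) (x : E3) :
    ∫⁻ p in Icc a b, ENNReal.ofReal (-deriv φ p) *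
      ∫⁻ z, ENNReal.ofReal (fluxDensity u x p z) ∂((volume.restrict (Icc 0 s)).prod sphereMeasure)
      ≤ ENNReal.ofReal (6 * E) := by
  have hψc := h.continuous_deriv
  have hfc := hu.continuous_fluxDensity x
  have hU := hu.contDiff.continuous
  have hψ0 : ∀ p, 0 ≤ -deriv φ p := fun p => neg_nonneg.2 (h.deriv_nonpos p)
  let F : ℝ → ℝ × Metric.sphere (0 : E3) 1 → ℝ≥0∞ := fun p z =>
    ENNReal.ofReal (-deriv φ p) * ENNReal.ofReal (fluxDensity u x p z)
  have hF : Measurable (uncurry F) := by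
    have : Measurable fun w : ℝ × ℝ × Metric.sphere (0 : E3) 1 =>
        ENNReal.ofReal (uncurry (fluxDensity u x) w) := hfc.measurable.ennreal_ofReal
    exact (Measurable.ennreal_ofReal (by fun_prop)).mul this
  have hslice : ∀ τ ∈ Icc 0 s, ∫⁻ p in Icc a b, ∫⁻ ω, F p (τ, ω) ∂sphereMeasure ≤
      ∫⁻ y, ENNReal.ofReal (-deriv φ (τ + ‖y - x‖) * u τ y ^ 6) := fun τ hτ => by
    have hm : Measurable fun y => ENNReal.ofReal (-deriv φ (τ + ‖y - x‖) * u τ y ^ 6) := by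
      have := (hu.contDiff_slice τ).continuous
      exact Measurable.ennreal_ofReal (Continuous.measurable (by fun_prop))
    rw [lintegral_polar hm x, ← lintegral_indicator measurableSet_Ioi]
    refine le_trans ?_ (lintegral_sub_right_eq_self _ τ).le
    refine le_trans (setLIntegral_mono' measurableSet_Icc fun p hp => ?_)
      (setLIntegral_le_lintegral (Icc a b) _)
    have hpos : 0 < p - τ := by linarith [hp.1, hτ.2]
    rw [indicator_of_mem (mem_Ioi.2 hpos)]
    refine lintegral_mono fun ω => le_of_eq ?_
    have hn : ‖x + (p - τ) • (ω : E3) - x‖ = p - τ := by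
      rw [add_sub_cancel_left, norm_smul, norm_eq_of_mem_sphere, mul_one,
        Real.norm_of_nonneg hpos.le]
    simp only [F, fluxDensity]
    rw [hn, add_sub_cancel, ← ENNReal.ofReal_mul (hψ0 p), ← ENNReal.ofReal_mul (sq_nonneg _)]
    congr 1; ring
  calc _ = ∫⁻ p in Icc a b, ∫⁻ z, F p z ∂((volume.restrict (Icc 0 s)).prod sphereMeasure) := by
        refine lintegral_congr fun p => ?_
        rw [lintegral_const_mul]
        exact (hfc.comp (by fun_prop : Continuous fun z => (p, z))).measurable.ennreal_ofReal
    _ = ∫⁻ p in Icc a b, ∫⁻ τ in Icc 0 s, ∫⁻ ω, F p (τ, ω) ∂sphereMeasure := by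
        refine lintegral_congr fun p => lintegral_prod _ ?_
        exact (hF.comp measurable_prodMk_left).aemeasurable
    _ = ∫⁻ τ in Icc 0 s, ∫⁻ p in Icc a b, ∫⁻ ω, F p (τ, ω) ∂sphereMeasure := by
        refine lintegral_lintegral_swap (Measurable.aemeasurable ?_)
        have : Measurable fun w : (ℝ × ℝ) × Metric.sphere (0 : E3) 1 => F w.1.1 (w.1.2, w.2) :=
          hF.comp (by fun_prop : Measurable
            fun w : (ℝ × ℝ) × Metric.sphere (0 : E3) 1 => (w.1.1, (w.1.2, w.2)))
        exact this.lintegral_prod_right'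
    _ ≤ ∫⁻ τ in Icc 0 s, ∫⁻ y, ENNReal.ofReal (-deriv φ (τ + ‖y - x‖) * u τ y ^ 6) :=
        setLIntegral_mono' measurableSet_Icc hslice
    _ ≤ _ := hu.lintegral_cutoff_le h hE hs hsa x

lemma IsCutoff.lintegral_neg_deriv {φ : ℝ → ℝ} {a b : ℝ} (h : IsCutoff φ a b) (hab : a ≤ b) :
    ∫⁻ p in Icc a b, ENNReal.ofReal (-deriv φ p) = 1 := by
  have hc : Continuous fun p => -deriv φ p := h.continuous_deriv.neg
  rw [← ofReal_integral_eq_lintegral_ofReal (hc.continuousOn.integrableOn_compact isCompact_Icc)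
    (.of_forall fun p => neg_nonneg.2 (h.deriv_nonpos p)), integral_Icc_eq_integral_Ioc,
    ← intervalIntegral.integral_of_le hab, intervalIntegral.integral_neg,
    intervalIntegral.integral_deriv_eq_sub (fun p _ => h.contDiff.differentiable (by simp) p)
      (h.continuous_deriv.intervalIntegrable _ _), h.eq_one a le_rfl, h.eq_zero b le_rfl]
  simp

lemma IsNLW.lintegral_fluxDensity_le (hu : IsNLW u) {s t E : ℝ}
    (hE : ∀ t, energy u t ≤ E) (hs : 0 ≤ s) (hst : s < t) (x : E3) :
    ∫⁻ z, ENNReal.ofReal (fluxDensity u x t z) ∂((volume.restrict (Icc 0 s)).prod sphereMeasure)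
      ≤ ENNReal.ofReal (6 * E) := by
  have hfc := hu.continuous_fluxDensity x
  have hμ : (volume.restrict (Icc 0 s)).prod sphereMeasure =
      (volume.prod sphereMeasure).restrict (Icc 0 s ×ˢ univ) := by
    rw [← Measure.prod_restrict, Measure.restrict_univ]
  set μ := (volume.restrict (Icc 0 s)).prod sphereMeasure
  let G : ℝ → ℝ := fun p => ∫ z, fluxDensity u x p z ∂μ
  have hK : IsCompact (Icc 0 s ×ˢ (univ : Set (Metric.sphere (0 : E3) 1))) :=
    isCompact_Icc.prod isCompact_univ
  have hGc : Continuous G := by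
    simp only [G, hμ]
    exact continuous_parametric_integral_of_continuous hfc hK
  have hG : ∀ p, ∫⁻ z, ENNReal.ofReal (fluxDensity u x p z) ∂μ = ENNReal.ofReal (G p) := fun p => by
    refine (ofReal_integral_eq_lintegral_ofReal ?_ (.of_forall (fluxDensity_nonneg x p))).symm
    rw [hμ]
    exact (hfc.comp (by fun_prop : Continuous fun z => (p, z))).continuousOn.integrableOn_compact hK
  have hE0 : 0 ≤ 6 * E := by linarith [hu.energy_nonneg 0, hE 0]
  rw [hG]
  refine ENNReal.ofReal_le_ofReal (le_of_not_gt fun hlt => ?_)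
  obtain ⟨m, hEm, hmG⟩ := exists_between hlt
  have hev : ∀ᶠ p in nhds t, m < G p ∧ s < p :=
    (hGc.continuousAt.eventually (lt_mem_nhds hmG)).and (lt_mem_nhds hst)
  obtain ⟨δ, hδ, hball⟩ := Metric.eventually_nhds_iff_ball.1 hev
  have hin : ∀ p ∈ Icc (t - δ / 2) (t + δ / 2), m < G p ∧ s < p := fun p hp =>
    hball p (by rw [Metric.mem_ball, Real.dist_eq, abs_lt]; constructor <;> linarith [hp.1, hp.2])
  obtain ⟨φ, hφ⟩ := IsCutoff.exists_of_lt (show t - δ / 2 < t + δ / 2 by linarith)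
  have hle := hu.lintegral_fluxDensity_mul_le hφ hE hs (hin _ (left_mem_Icc.2 (by linarith))).2 x
  have : ENNReal.ofReal m ≤ ENNReal.ofReal (6 * E) := by
    have hm : Measurable fun p => ENNReal.ofReal (-deriv φ p) :=
      hφ.continuous_deriv.neg.measurable.ennreal_ofReal
    calc ENNReal.ofReal m = ∫⁻ p in Icc (t - δ / 2) (t + δ / 2),
          ENNReal.ofReal (-deriv φ p) * ENNReal.ofReal m := by
          rw [lintegral_mul_const _ hm, hφ.lintegral_neg_deriv (by linarith), one_mul]
      _ ≤ _ := by
          refine setLIntegral_mono' measurableSet_Icc fun p hp => ?_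
          rw [hG]
          gcongr
          exact (hin p hp).1.le
      _ ≤ _ := hle
  exact absurd ((ENNReal.ofReal_le_ofReal_iff hE0).1 this) (not_le.2 hEm)

end Solution

lemma lintegral_inv_pow_four_le {T t s : ℝ} (hT : 0 < T) (hs : 0 ≤ s) (hst : s ≤ t - T) :
    ∫⁻ τ in Icc 0 s, ENNReal.ofReal (((t - τ) ^ 4)⁻¹) ≤ ENNReal.ofReal ((3 * T ^ 3)⁻¹) := by
  have hpos : ∀ τ ∈ Icc 0 s, 0 < t - τ := fun τ hτ => by linarith [hτ.2]
  have hc : ContinuousOn (fun τ => ((t - τ) ^ 4)⁻¹) (Icc 0 s) :=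
    ContinuousOn.inv₀ (by fun_prop) fun τ hτ => (pow_pos (hpos τ hτ) 4).ne'
  have hd : ∀ τ ∈ uIcc 0 s, HasDerivAt (fun τ => (3 * (t - τ) ^ 3)⁻¹) (((t - τ) ^ 4)⁻¹) τ := by
    rw [uIcc_of_le hs]
    intro τ hτ
    have h0 := (hpos τ hτ).ne'
    have h1 : HasDerivAt (fun τ => 3 * (t - τ) ^ 3) (3 * (3 * (t - τ) ^ 2 * (-1))) τ := by
      simpa using (((hasDerivAt_id τ).const_sub t).pow 3).const_mul 3
    refine (h1.fun_inv (by positivity)).congr_deriv ?_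
    field_simp
  rw [← ofReal_integral_eq_lintegral_ofReal (hc.integrableOn_compact isCompact_Icc)
    (.of_forall fun τ => by positivity), integral_Icc_eq_integral_Ioc,
    ← intervalIntegral.integral_of_le hs, intervalIntegral.integral_eq_sub_of_hasDerivAt hd
      (ContinuousOn.intervalIntegrable (by rwa [uIcc_of_le hs]))]
  refine ENNReal.ofReal_le_ofReal ((sub_le_self _ ?_).trans ?_)
  · have := hpos 0 (left_mem_Icc.2 hs)
    positivity
  · have : T ≤ t - s := by linarith
    gcongr

lemma IsNLW.lintegral_cone_le {u : ℝ → E3 → ℝ} (hu : IsNLW u) {T t s E : ℝ}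
    (hE : ∀ t, energy u t ≤ E) (hT : 0 < T) (hs : 0 ≤ s) (hst : s ≤ t - T) (x : E3) :
    ∫⁻ τ in Icc 0 s, ∫⁻ ω, ENNReal.ofReal ((t - τ) * |u τ (x + (t - τ) • (ω : E3))| ^ 5)
        ∂sphereMeasure ≤
      ENNReal.ofReal (6 * E) ^ (5 / 6 : ℝ) *
        (ENNReal.ofReal ((3 * T ^ 3)⁻¹) * sphereMeasure univ) ^ (1 / 6 : ℝ) := by
  set μ := (volume.restrict (Icc 0 s)).prod sphereMeasure
  let f : ℝ × Metric.sphere (0 : E3) 1 → ℝ≥0∞ := fun z => ENNReal.ofReal (fluxDensity u x t z)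
  let g : ℝ × Metric.sphere (0 : E3) 1 → ℝ≥0∞ := fun z => ENNReal.ofReal (((t - z.1) ^ 4)⁻¹)
  have hf : Measurable f :=
    ((hu.continuous_fluxDensity x).comp
      (by fun_prop : Continuous fun z => (t, z))).measurable.ennreal_ofReal
  have hg : Measurable g := Measurable.ennreal_ofReal (by fun_prop)
  have hgμ : ∫⁻ z, g z ∂μ ≤ ENNReal.ofReal ((3 * T ^ 3)⁻¹) * sphereMeasure univ := by
    rw [lintegral_prod _ hg.aemeasurable]
    simp only [g, lintegral_const]
    rw [lintegral_mul_const _ (Measurable.ennreal_ofReal (by fun_prop))]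
    gcongr
    exact lintegral_inv_pow_four_le hT hs hst
  have hpt : ∀ τ ∈ Icc 0 s, ∀ ω : Metric.sphere (0 : E3) 1,
      ENNReal.ofReal ((t - τ) * |u τ (x + (t - τ) • (ω : E3))| ^ 5) =
        f (τ, ω) ^ (5 / 6 : ℝ) * g (τ, ω) ^ (1 / 6 : ℝ) := fun τ hτ ω => by
    have hr : 0 < t - τ := by linarith [hτ.2]
    simp only [f, g]
    rw [ENNReal.ofReal_rpow_of_nonneg (fluxDensity_nonneg x t _) (by norm_num),
      ENNReal.ofReal_rpow_of_nonneg (by positivity) (by norm_num),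
      ← ENNReal.ofReal_mul (Real.rpow_nonneg (fluxDensity_nonneg x t _) _)]
    congr 1
    simp only [fluxDensity]
    set r := t - τ
    set v := u τ (x + r • (ω : E3))
    rw [← (show Even 6 by decide).pow_abs v, Real.mul_rpow (by positivity) (by positivity),
      Real.inv_rpow (by positivity), ← Real.rpow_natCast r 2, ← Real.rpow_natCast r 4,
      ← Real.rpow_natCast |v| 6, ← Real.rpow_mul hr.le, ← Real.rpow_mul hr.le,
      ← Real.rpow_mul (abs_nonneg v), ← Real.rpow_neg hr.le, mul_right_comm,
      ← Real.rpow_add hr, ← Real.rpow_natCast |v| 5]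
    norm_num
  calc _ = ∫⁻ τ in Icc 0 s, ∫⁻ ω, f (τ, ω) ^ (5 / 6 : ℝ) * g (τ, ω) ^ (1 / 6 : ℝ)
        ∂sphereMeasure :=
        setLIntegral_congr_fun measurableSet_Icc fun τ hτ => lintegral_congr (hpt τ hτ)
    _ = ∫⁻ z, f z ^ (5 / 6 : ℝ) * g z ^ (1 / 6 : ℝ) ∂μ :=
        (lintegral_prod _ ((hf.pow_const _).mul (hg.pow_const _)).aemeasurable).symm
    _ ≤ (∫⁻ z, f z ∂μ) ^ (5 / 6 : ℝ) * (∫⁻ z, g z ∂μ) ^ (1 / 6 : ℝ) :=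
        ENNReal.lintegral_mul_norm_pow_le hf.aemeasurable hg.aemeasurable (by norm_num)
          (by norm_num) (by norm_num)
    _ ≤ _ := by
        gcongr
        exact hu.lintegral_fluxDensity_le hE hs (by linarith) x

lemma IsNLW.enorm_duh_le {u : ℝ → E3 → ℝ} (hu : IsNLW u) {K : ℝ≥0∞}
    (hK : ∀ (x : E3) (r : ℝ), 0 < r → ∀ f : E3 → ℝ≥0∞, Measurable f →
      ∫⁻ y in Metric.sphere x r, f y ∂(μH[2]) ≤
        K * (ENNReal.ofReal (r ^ 2) * ∫⁻ ω, f (x + r • (ω : E3)) ∂sphereMeasure))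
    {t s : ℝ} (hs : 0 ≤ s) (hst : s < t) (x : E3) :
    ‖duh u 0 s t x‖ₑ ≤ K * ∫⁻ τ in Icc 0 s, ∫⁻ ω,
      ENNReal.ofReal ((t - τ) * |u τ (x + (t - τ) • (ω : E3))| ^ 5) ∂sphereMeasure := by
  have hU := hu.contDiff.continuous
  have hm : Measurable fun τ => ∫⁻ ω,
      ENNReal.ofReal ((t - τ) * |u τ (x + (t - τ) • (ω : E3))| ^ 5) ∂sphereMeasure := by
    have : Continuous fun z : ℝ × Metric.sphere (0 : E3) 1 =>
        (t - z.1) * |uncurry u (z.1, x + (t - z.1) • (z.2 : E3))| ^ 5 := by fun_prop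
    exact this.measurable.ennreal_ofReal.lintegral_prod_right'
  rw [duh, intervalIntegral.integral_of_le hs, ← integral_Icc_eq_integral_Ioc,
    ← lintegral_const_mul _ hm]
  refine (enorm_integral_le_lintegral_enorm _).trans
    (setLIntegral_mono' measurableSet_Icc fun τ hτ => ?_)
  have hr : 0 < t - τ := by linarith [hτ.2]
  set r := t - τ
  have hcont := (hu.contDiff_slice τ).continuous
  have hc : ‖1 / (4 * π * r)‖ₑ ≤ ENNReal.ofReal r⁻¹ := by
    rw [Real.enorm_of_nonneg (by positivity), one_div]
    refine ENNReal.ofReal_le_ofReal (inv_anti₀ hr (le_mul_of_one_le_left hr.le ?_))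
    linarith [Real.pi_gt_three]
  have hv : ∀ y, ‖u τ y ^ 5‖ₑ = ENNReal.ofReal (|u τ y| ^ 5) := fun y => by
    rw [← ofReal_norm, norm_pow, Real.norm_eq_abs]
  calc ‖1 / (4 * π * r) * sphInt x r fun y => u τ y ^ 5‖ₑ
      ≤ ENNReal.ofReal r⁻¹ * ∫⁻ y in Metric.sphere x r, ENNReal.ofReal (|u τ y| ^ 5) ∂(μH[2]) := by
        rw [enorm_mul]
        refine mul_le_mul' hc ((enorm_integral_le_lintegral_enorm _).trans_eq ?_)
        simp_rw [hv]
    _ ≤ ENNReal.ofReal r⁻¹ * (K * (ENNReal.ofReal (r ^ 2) *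
          ∫⁻ ω, ENNReal.ofReal (|u τ (x + r • (ω : E3))| ^ 5) ∂sphereMeasure)) := by
        gcongr
        exact hK x r hr _ (Measurable.ennreal_ofReal (Continuous.measurable (by fun_prop)))
    _ = K * (ENNReal.ofReal r *
          ∫⁻ ω, ENNReal.ofReal (|u τ (x + r • (ω : E3))| ^ 5) ∂sphereMeasure) := by
        rw [mul_left_comm, ← mul_assoc (ENNReal.ofReal r⁻¹),
          ← ENNReal.ofReal_mul (by positivity), show r⁻¹ * r ^ 2 = r by field_simp]
    _ = _ := by
        rw [← lintegral_const_mul _ (Measurable.ennreal_ofReal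
          (Continuous.measurable (by fun_prop)))]
        simp_rw [← ENNReal.ofReal_mul hr.le]

/-- pointwise bound `|∫_0^s S(t-τ)(0,u⁵) dτ| ≤ C E^{5/6} T^{-1/2}`
for `0 ≤ s ≤ t - T`. -/
theorem stmt9 :
    ∃ C : ℝ, 0 < C ∧ ∀ (E : ℝ) (u : ℝ → E3 → ℝ), IsNLW u → (∀ t : ℝ, energy u t ≤ E) →
      ∀ (T t s : ℝ), 0 < T → 0 ≤ s → s ≤ t - T → ∀ x : E3,
        |duh u 0 s t x| ≤ C * E ^ ((5:ℝ)/6) * T ^ (-(1:ℝ)/2) := by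
  obtain ⟨K, hKtop, hK⟩ := exists_lintegral_sphere_le
  set S := sphereMeasure univ
  have hS : S ≠ ∞ := measure_ne_top _ _
  refine ⟨K.toReal * (6 ^ (5 / 6 : ℝ) * (S.toReal / 3) ^ (1 / 6 : ℝ)) + 1, by positivity,
    fun E u hu hE T t s hT hs hst x => ?_⟩
  have hE0 : 0 ≤ E := (hu.energy_nonneg 0).trans (hE 0)
  have hle := (hu.enorm_duh_le hK hs (by linarith : s < t) x).trans
    (mul_le_mul_right (hu.lintegral_cone_le hE hT hs hst x) K)
  have hT' : ((3 * T ^ 3)⁻¹ * S.toReal) ^ (1 / 6 : ℝ) =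
      (S.toReal / 3) ^ (1 / 6 : ℝ) * T ^ (-(1 : ℝ) / 2) := by
    rw [show (3 * T ^ 3)⁻¹ * S.toReal = S.toReal / 3 * (T ^ 3)⁻¹ by field_simp,
      Real.mul_rpow (by positivity) (by positivity), Real.inv_rpow (by positivity),
      ← Real.rpow_natCast T 3, ← Real.rpow_mul hT.le, ← Real.rpow_neg hT.le]
    norm_num
  have hreal := ENNReal.toReal_mono (by finiteness) hle
  rw [toReal_enorm, Real.norm_eq_abs, ENNReal.toReal_mul, ENNReal.toReal_mul,
    ← ENNReal.toReal_rpow, ← ENNReal.toReal_rpow, ENNReal.toReal_mul,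
    ENNReal.toReal_ofReal (by positivity), ENNReal.toReal_ofReal (by positivity), hT',
    Real.mul_rpow (by norm_num) hE0] at hreal
  have hnn : 0 ≤ E ^ (5 / 6 : ℝ) * T ^ (-(1 : ℝ) / 2) := by positivity
  linarith

end
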